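/- For every n ≥ 1, every permutation σ of [n], and every 0 ≤ k ≤ n, let c⁰ be the all-zero function on {0,1,…,n} and let c^k be the indicator of k (c^k(k) = 1 and c^k(i) = 0 for i ≠ k). Then f_σ^{c⁰} and f_σ^{c^k} are both submodular, they agree on every subset S ⊆ [n] with S ≠ R_k, and min_{S ⊆ [n]} f_σ^{c⁰}(S) = 0 while min_{S ⊆ [n]} f_σ^{c^k}(S) = −1. -/

import Mathlib

open scoped Classical

/-- The important set `R_i = {σ(1), …, σ(i)}`, for `0 ≤ i ≤ n`. -/
noncomputable def impSet (n : ℕ) (σ : Equiv.Perm (Fin n)) (i : ℕ) : Finset (Fin n) :=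
  Finset.univ.filter (fun x => (σ.symm x : ℕ) < i)

/-- `jS n σ S` is the largest `j ≤ n` with `R_j ⊆ S` (well-defined since `R_0 = ∅`). -/
noncomputable def jS (n : ℕ) (σ : Equiv.Perm (Fin n)) (S : Finset (Fin n)) : ℕ :=
  Nat.findGreatest (fun j => impSet n σ j ⊆ S) n

/-- The function `f_σ^c`: equal to `-c_i` on the important set `R_i`
(note `|R_i| = i`), and `(|S| - j(S)) * (n + 2 - j(S))` on unimportant sets. -/
noncomputable def fsc (n : ℕ) (σ : Equiv.Perm (Fin n)) (c : ℕ → ℝ)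
    (S : Finset (Fin n)) : ℝ :=
  if ∃ i ≤ n, S = impSet n σ i then -(c S.card)
  else ((S.card : ℝ) - (jS n σ S : ℕ)) * ((n : ℝ) + 2 - (jS n σ S : ℕ))

theorem card_impSet {n : ℕ} (σ : Equiv.Perm (Fin n)) {i : ℕ} (hi : i ≤ n) :
    (impSet n σ i).card = i := by
  have h : impSet n σ i
      = (Finset.univ.filter (fun y : Fin n => (y : ℕ) < i)).map σ.toEmbedding := by
    ext x
    simp [impSet, Finset.mem_map_equiv]
  rw [h, Finset.card_map, Fin.card_filter_val_lt, min_eq_right hi]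

theorem impSet_mono {n : ℕ} (σ : Equiv.Perm (Fin n)) : Monotone (impSet n σ) := by
  intro i j hij x hx
  simp only [impSet, Finset.mem_filter, Finset.mem_univ, true_and] at hx ⊢
  omega

theorem jS_le {n : ℕ} (σ : Equiv.Perm (Fin n)) (S : Finset (Fin n)) : jS n σ S ≤ n :=
  Nat.findGreatest_le n

theorem impSet_jS_subset {n : ℕ} (σ : Equiv.Perm (Fin n)) (S : Finset (Fin n)) :
    impSet n σ (jS n σ S) ⊆ S :=
  Nat.findGreatest_spec (P := fun j => impSet n σ j ⊆ S) (Nat.zero_le n) (by simp [impSet])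

theorem impSet_subset_iff {n : ℕ} (σ : Equiv.Perm (Fin n)) {S : Finset (Fin n)} {i : ℕ}
    (hi : i ≤ n) : impSet n σ i ⊆ S ↔ i ≤ jS n σ S :=
  ⟨fun h => Nat.le_findGreatest hi h, fun h => (impSet_mono σ h).trans (impSet_jS_subset σ S)⟩

theorem jS_le_card {n : ℕ} (σ : Equiv.Perm (Fin n)) (S : Finset (Fin n)) :
    jS n σ S ≤ S.card := by
  simpa [card_impSet σ (jS_le σ S)] using Finset.card_le_card (impSet_jS_subset σ S)

theorem impSet_jS_eq {n : ℕ} (σ : Equiv.Perm (Fin n)) {S : Finset (Fin n)}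
    (h : S.card = jS n σ S) : impSet n σ (jS n σ S) = S :=
  Finset.eq_of_subset_of_card_le (impSet_jS_subset σ S) (by rw [card_impSet σ (jS_le σ S), h])

theorem exists_eq_impSet_iff {n : ℕ} (σ : Equiv.Perm (Fin n)) (S : Finset (Fin n)) :
    (∃ i ≤ n, S = impSet n σ i) ↔ S.card = jS n σ S := by
  constructor
  · rintro ⟨i, hi, rfl⟩
    refine le_antisymm ?_ (jS_le_card σ _)
    rw [card_impSet σ hi]
    exact (impSet_subset_iff σ hi).1 subset_rfl
  · exact fun h => ⟨_, jS_le σ S, (impSet_jS_eq σ h).symm⟩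

theorem jS_mono {n : ℕ} (σ : Equiv.Perm (Fin n)) : Monotone (jS n σ) := fun _ _ h =>
  (impSet_subset_iff σ (jS_le σ _)).1 ((impSet_jS_subset σ _).trans h)

theorem jS_inter_of_le {n : ℕ} (σ : Equiv.Perm (Fin n)) {X Y : Finset (Fin n)}
    (h : jS n σ X ≤ jS n σ Y) : jS n σ (X ∩ Y) = jS n σ X :=
  le_antisymm (jS_mono σ Finset.inter_subset_left) <|
    (impSet_subset_iff σ (jS_le σ X)).1 <| Finset.subset_inter (impSet_jS_subset σ X)
      ((impSet_subset_iff σ (jS_le σ X)).2 h)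

theorem fsc_eq_sub {n : ℕ} (σ : Equiv.Perm (Fin n)) (c : ℕ → ℝ) (S : Finset (Fin n)) :
    fsc n σ c S = ((S.card : ℝ) - jS n σ S) * ((n : ℝ) + 2 - jS n σ S)
      - if S.card = jS n σ S then c S.card else 0 := by
  unfold fsc
  simp only [exists_eq_impSet_iff]
  split_ifs with h
  · simp [h]
  · simp

/-- Submodularity of `f_σ^c` on a pair of incomparable sets. -/
theorem fsc_union_add_inter_le_of_incomparable {n : ℕ} (σ : Equiv.Perm (Fin n)) {c : ℕ → ℝ}
    (hc0 : ∀ i, 0 ≤ c i) (hc1 : ∀ i, c i ≤ 1) {X Y : Finset (Fin n)} (hXY : ¬ X ⊆ Y)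
    (hYX : ¬ Y ⊆ X) (hj : jS n σ X ≤ jS n σ Y) :
    fsc n σ c (X ∪ Y) + fsc n σ c (X ∩ Y) ≤ fsc n σ c X + fsc n σ c Y := by
  have hX : X.card ≠ jS n σ X := fun h => hXY <| by
    rw [← impSet_jS_eq σ h]
    exact (impSet_subset_iff σ (jS_le σ X)).2 hj
  have hYj : Y.card = jS n σ Y → jS n σ X + 1 ≤ jS n σ Y := fun h => by
    by_contra! hlt
    refine hYX ?_
    rw [← impSet_jS_eq σ h]
    exact (impSet_subset_iff σ (jS_le σ Y)).2 (by omega)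
  have hcard := Finset.card_union_add_card_inter X Y
  have hpr : (X ∩ Y).card + 1 ≤ X.card := Finset.card_lt_card
    ⟨Finset.inter_subset_left, fun h => hXY (h.trans Finset.inter_subset_right)⟩
  have hd : jS n σ Y ≤ jS n σ (X ∪ Y) := jS_mono σ Finset.subset_union_right
  have hdn := jS_le σ (X ∪ Y)
  have hY := jS_le_card σ Y
  have hU : 0 ≤ if (X ∪ Y).card = jS n σ (X ∪ Y) then c (X ∪ Y).card else 0 := by
    split_ifs
    exacts [hc0 _, le_rfl]
  have hI : 0 ≤ if (X ∩ Y).card = jS n σ X then c (X ∩ Y).card else 0 := by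
    split_ifs
    exacts [hc0 _, le_rfl]
  simp only [fsc_eq_sub, jS_inter_of_le σ hj, if_neg hX]
  generalize jS n σ X = a at *
  generalize jS n σ Y = b at *
  generalize jS n σ (X ∪ Y) = d at *
  have hcard' : ((X ∪ Y).card : ℝ) = X.card + Y.card - (X ∩ Y).card := by
    rw [eq_sub_iff_add_eq]
    exact_mod_cast hcard
  have hpr' : ((X ∩ Y).card : ℝ) + 1 ≤ X.card := by exact_mod_cast hpr
  have hj' : (a : ℝ) ≤ b := by exact_mod_cast hj
  have hd' : (b : ℝ) ≤ d := by exact_mod_cast hd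
  have hdn' : (d : ℝ) ≤ n := by exact_mod_cast hdn
  have hY' : (b : ℝ) ≤ Y.card := by exact_mod_cast hY
  have key : ((X.card : ℝ) - a) * (n + 2 - a) + (Y.card - b) * (n + 2 - b)
      - ((X ∪ Y).card - d) * (n + 2 - d) - ((X ∩ Y).card - a) * (n + 2 - a)
      = (X.card - (X ∩ Y).card) * (d - a) + (Y.card - b) * (d - b)
        + (d - b) * (n + 2 - d) := by
    rw [hcard']
    ring
  have h1 : (d : ℝ) - a ≤ (X.card - (X ∩ Y).card) * (d - a) :=
    le_mul_of_one_le_left (by linarith) (by linarith)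
  have h2 : 0 ≤ ((Y.card : ℝ) - b) * (d - b) := mul_nonneg (by linarith) (by linarith)
  have h3 : 0 ≤ ((d : ℝ) - b) * (n + 2 - d) := mul_nonneg (by linarith) (by linarith)
  have h4 : (if Y.card = b then c Y.card else 0) ≤ (d : ℝ) - a := by
    split_ifs with h
    · have : (a : ℝ) + 1 ≤ b := by exact_mod_cast hYj h
      linarith [hc1 Y.card]
    · linarith
  linarith

theorem fsc_union_add_inter_le {n : ℕ} (σ : Equiv.Perm (Fin n)) {c : ℕ → ℝ}
    (hc0 : ∀ i, 0 ≤ c i) (hc1 : ∀ i, c i ≤ 1) (X Y : Finset (Fin n)) :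
    fsc n σ c (X ∪ Y) + fsc n σ c (X ∩ Y) ≤ fsc n σ c X + fsc n σ c Y := by
  by_cases hXY : X ⊆ Y
  · rw [Finset.union_eq_right.2 hXY, Finset.inter_eq_left.2 hXY, add_comm]
  by_cases hYX : Y ⊆ X
  · rw [Finset.union_eq_left.2 hYX, Finset.inter_eq_right.2 hYX]
  rcases le_total (jS n σ X) (jS n σ Y) with h | h
  · exact fsc_union_add_inter_le_of_incomparable σ hc0 hc1 hXY hYX h
  · rw [Finset.union_comm, Finset.inter_comm, add_comm (fsc n σ c X)]
    exact fsc_union_add_inter_le_of_incomparable σ hc0 hc1 hYX hXY h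

theorem fsc_impSet {n : ℕ} (σ : Equiv.Perm (Fin n)) (c : ℕ → ℝ) {i : ℕ} (hi : i ≤ n) :
    fsc n σ c (impSet n σ i) = -c i := by
  rw [fsc, if_pos ⟨i, hi, rfl⟩, card_impSet σ hi]

theorem neg_le_fsc {n : ℕ} (σ : Equiv.Perm (Fin n)) {c : ℕ → ℝ} {b : ℝ} (hb : 0 ≤ b)
    (hc : ∀ i, c i ≤ b) (S : Finset (Fin n)) : -b ≤ fsc n σ c S := by
  unfold fsc
  split_ifs
  · exact neg_le_neg (hc _)
  · have h1 : (jS n σ S : ℝ) ≤ S.card := by exact_mod_cast jS_le_card σ S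
    have h2 : (jS n σ S : ℝ) ≤ n := by exact_mod_cast jS_le σ S
    exact (neg_nonpos.2 hb).trans (mul_nonneg (by linarith) (by linarith))

/-- With `c⁰ ≡ 0` and `c^k` the indicator of `k` (for `0 ≤ k ≤ n`):
both `f_σ^{c⁰}` and `f_σ^{c^k}` are submodular, they agree on every
`S ≠ R_k`, and the minimum of `f_σ^{c⁰}` is `0` while that of `f_σ^{c^k}` is `-1`. -/
theorem stmt_4 (n : ℕ) (hn : 1 ≤ n) (σ : Equiv.Perm (Fin n)) (k : ℕ) (hk : k ≤ n)
    (c0 ck : ℕ → ℝ) (hc0 : ∀ i, c0 i = 0)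
    (hck : ∀ i, ck i = if i = k then 1 else 0) :
    (∀ X Y : Finset (Fin n),
      fsc n σ c0 (X ∪ Y) + fsc n σ c0 (X ∩ Y) ≤ fsc n σ c0 X + fsc n σ c0 Y) ∧
    (∀ X Y : Finset (Fin n),
      fsc n σ ck (X ∪ Y) + fsc n σ ck (X ∩ Y) ≤ fsc n σ ck X + fsc n σ ck Y) ∧
    (∀ S : Finset (Fin n), S ≠ impSet n σ k → fsc n σ c0 S = fsc n σ ck S) ∧
    IsLeast (Set.range (fsc n σ c0)) 0 ∧
    IsLeast (Set.range (fsc n σ ck)) (-1) := by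
  have hck0 : ∀ i, 0 ≤ ck i := fun i => by rw [hck]; split_ifs <;> norm_num
  have hck1 : ∀ i, ck i ≤ 1 := fun i => by rw [hck]; split_ifs <;> norm_num
  refine ⟨fsc_union_add_inter_le σ (fun i => (hc0 i).ge) (fun i => by simp [hc0]),
    fsc_union_add_inter_le σ hck0 hck1, ?_, ⟨⟨impSet n σ k, ?_⟩, ?_⟩,
    ⟨⟨impSet n σ k, ?_⟩, ?_⟩⟩
  · intro S hS
    unfold fsc
    split_ifs with h
    · obtain ⟨i, hi, rfl⟩ := h
      have hik : i ≠ k := fun h => hS (h ▸ rfl)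
      rw [card_impSet σ hi, hc0, hck, if_neg hik]
    · rfl
  · rw [fsc_impSet σ c0 hk, hc0, neg_zero]
  · rintro _ ⟨S, rfl⟩
    simpa using neg_le_fsc σ le_rfl (fun i => (hc0 i).le) S
  · rw [fsc_impSet σ ck hk, hck, if_pos rfl]
  · rintro _ ⟨S, rfl⟩
    exact neg_le_fsc σ zero_le_one hck1 S
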